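/- Under the standing assumptions, let p(m) be the least prime divisor of m, d(m) the number of positive divisors of m, and ω(m) the number of distinct prime divisors of m. Then d(m) < 2·max{p(m), x} and ω(m) < log(2·max{p(m), x}) / log 2. -/

import Mathlib

section
open Polynomial

noncomputable def homEval (a b : ℕ) (f : ℤ[X]) : ℤ := (f.scaleRoots (b : ℤ)).eval (a : ℤ)

lemma homEval_cast (K : Type*) [Field K] (a b : ℕ) (hb : (b : K) ≠ 0) (f : ℤ[X]) :
    ((homEval a b f : ℤ) : K) =
      (b : K) ^ f.natDegree * (f.map (Int.castRingHom K)).eval ((a : K) / b) := by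
  have h := scaleRoots_eval₂_mul (p := f) (Int.castRingHom K) ((a : K) / b) (b : ℤ)
  have h1 : (Int.castRingHom K) (b : ℤ) * ((a : K) / b) = (Int.castRingHom K) (a : ℤ) := by
    simp [mul_div_cancel₀ _ hb]
  rw [h1, eval₂_at_apply] at h
  rw [eval_map]
  simpa [homEval] using h

lemma homEval_mul (a b : ℕ) (f g : ℤ[X]) :
    homEval a b (f * g) = homEval a b f * homEval a b g := by
  simp [homEval, mul_scaleRoots_of_noZeroDivisors]

lemma homEval_pow_sub (a b n : ℕ) (hb : 0 < b) :
    homEval a b (X ^ n - 1) = (a : ℤ) ^ n - (b : ℤ) ^ n := by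
  have hb' : (b : ℚ) ≠ 0 := by positivity
  have h := homEval_cast ℚ a b hb' (X ^ n - 1)
  have h2 : (X ^ n - 1 : ℤ[X]).natDegree = n := by
    simpa using natDegree_X_pow_sub_C (R := ℤ) (n := n) (r := 1)
  rw [h2] at h
  have : ((homEval a b (X ^ n - 1) : ℤ) : ℚ) = (((a : ℤ) ^ n - (b : ℤ) ^ n : ℤ) : ℚ) := by
    rw [h]; simp [div_pow, mul_sub, mul_div_cancel₀ _ (pow_ne_zero n hb')]
  exact_mod_cast this

lemma homEval_dvd1 (a b d : ℕ) (hb : 0 < b) (hd : 0 < d) :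
    homEval a b (cyclotomic d ℤ) ∣ (a : ℤ) ^ d - (b : ℤ) ^ d := by
  rw [← homEval_pow_sub a b d hb]
  obtain ⟨c, hc⟩ := cyclotomic.dvd_X_pow_sub_one d ℤ
  rw [hc, homEval_mul]
  exact dvd_mul_right _ _

lemma homEval_dvd2 (a b d p : ℕ) (hb : 0 < b) (hd : 0 < d) (hp : 1 < p) :
    ((a : ℤ) ^ d - (b : ℤ) ^ d) * homEval a b (cyclotomic (d * p) ℤ) ∣
      (a : ℤ) ^ (d * p) - (b : ℤ) ^ (d * p) := by
  rw [← homEval_pow_sub a b d hb, ← homEval_pow_sub a b (d * p) hb,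
    ← homEval_mul]
  obtain ⟨c, hc⟩ := X_pow_sub_one_mul_cyclotomic_dvd_X_pow_sub_one_of_dvd ℤ (d := d) (n := d * p)
    (by rw [Nat.mem_properDivisors]; exact ⟨Dvd.intro _ rfl, by nlinarith⟩)
  rw [hc, homEval_mul a b _ c]
  exact dvd_mul_right (homEval a b ((X ^ d - 1) * cyclotomic (d * p) ℤ)) (homEval a b c)

lemma ratio_pow_eq_one_iff (a b p j : ℕ) [Fact p.Prime] (hpb : ¬ p ∣ b) :
    ((a : ZMod p) / b) ^ j = 1 ↔ (p : ℤ) ∣ (a : ℤ) ^ j - (b : ℤ) ^ j := by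
  have hb : (b : ZMod p) ≠ 0 := by rwa [Ne, ZMod.natCast_eq_zero_iff]
  rw [div_pow, div_eq_one_iff_eq (pow_ne_zero _ hb), ← ZMod.intCast_zmod_eq_zero_iff_dvd]
  push_cast
  rw [sub_eq_zero]

lemma not_dvd_of_dvd_sub (a b p j : ℕ) (hp : p.Prime) (hab : a.Coprime b) (hj : 0 < j)
    (h : (p : ℤ) ∣ (a : ℤ) ^ j - (b : ℤ) ^ j) : ¬ p ∣ a ∧ ¬ p ∣ b := by
  have hp' := Nat.prime_iff_prime_int.1 hp
  constructor
  · intro ha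
    have h1 : (p : ℤ) ∣ (a : ℤ) ^ j := dvd_pow (by exact_mod_cast ha) hj.ne'
    have h2 : (p : ℤ) ∣ (b : ℤ) ^ j := (dvd_sub_right h1).1 h
    have h3 : p ∣ b := by exact_mod_cast hp'.dvd_of_dvd_pow h2
    exact hp.one_lt.ne' (Nat.dvd_one.1 (hab ▸ Nat.dvd_gcd ha h3))
  · intro ha
    have h1 : (p : ℤ) ∣ (b : ℤ) ^ j := dvd_pow (by exact_mod_cast ha) hj.ne'
    have h2 : (p : ℤ) ∣ (a : ℤ) ^ j := (dvd_sub_left h1).1 h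
    have h3 : p ∣ a := by exact_mod_cast hp'.dvd_of_dvd_pow h2
    exact hp.one_lt.ne' (Nat.dvd_one.1 (hab ▸ Nat.dvd_gcd h3 ha))

lemma order_of_dvd (a b p k e : ℕ) [hp : Fact p.Prime] (hb : 0 < b) (hab : a.Coprime b)
    (he : ¬ p ∣ e) (h : (p : ℤ) ∣ homEval a b (cyclotomic (p ^ k * e) ℤ)) :
    ¬ p ∣ a ∧ ¬ p ∣ b ∧ orderOf ((a : ZMod p) / b) = e := by
  have he0 : 0 < e := Nat.pos_of_ne_zero (by rintro rfl; simp at he)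
  have hd : 0 < p ^ k * e := Nat.mul_pos (pow_pos hp.out.pos _) he0
  obtain ⟨h1, h2⟩ := not_dvd_of_dvd_sub a b p _ hp.out hab hd (h.trans (homEval_dvd1 a b _ hb hd))
  refine ⟨h1, h2, ?_⟩
  have hb : (b : ZMod p) ≠ 0 := by rwa [Ne, ZMod.natCast_eq_zero_iff]
  have h3 := homEval_cast (ZMod p) a b hb (cyclotomic (p ^ k * e) ℤ)
  rw [(ZMod.intCast_zmod_eq_zero_iff_dvd _ p).2 h, map_cyclotomic] at h3
  have h4 := (mul_eq_zero.1 h3.symm).resolve_left (pow_ne_zero _ hb)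
  have : NeZero (e : ZMod p) := ⟨by rwa [Ne, ZMod.natCast_eq_zero_iff]⟩
  exact ((isRoot_cyclotomic_prime_pow_mul_iff_of_charP (p := p)).1 h4).eq_orderOf.symm

lemma order_dvd_sub_one (a b p : ℕ) [hp : Fact p.Prime] (h1 : ¬ p ∣ a) (h2 : ¬ p ∣ b) :
    orderOf ((a : ZMod p) / b) ∣ p - 1 := by
  apply ZMod.orderOf_dvd_card_sub_one
  apply div_ne_zero <;> rwa [Ne, ZMod.natCast_eq_zero_iff]

/-- `p ^ 2` does not divide the homogeneous cyclotomic value. -/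
lemma sq_not_dvd (a b p d : ℕ) [hp : Fact p.Prime] (hb : 0 < b) (hlt : b < a)
    (hab : a.Coprime b) (hd : 0 < d) (hne : d * p ≠ 2)
    (h : (p : ℤ) ∣ homEval a b (cyclotomic (d * p) ℤ)) :
    ¬ (p : ℤ) ^ 2 ∣ homEval a b (cyclotomic (d * p) ℤ) := by
  have hp0 := hp.out.pos
  have hdp : 0 < d * p := by positivity
  obtain ⟨k, e, hpe, hke⟩ := Nat.exists_eq_pow_mul_and_not_dvd hdp.ne' p hp.out.ne_one
  have h' := h
  rw [hke] at h'
  obtain ⟨hpa, hpb, hord⟩ := order_of_dvd a b p k e hb hab hpe h'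
  have hk : k ≠ 0 := by
    rintro rfl
    apply hpe
    rw [pow_zero, one_mul] at hke
    exact hke ▸ dvd_mul_left _ _
  obtain ⟨k, rfl⟩ := Nat.exists_eq_succ_of_ne_zero hk
  have hd2 : d = p ^ k * e := by
    have : p * d = p * (p ^ k * e) := by rw [mul_comm, hke, pow_succ]; ring
    exact Nat.eq_of_mul_eq_mul_left hp0 this
  have hed : e ∣ d := hd2 ▸ dvd_mul_left _ _
  have hpd : (p : ℤ) ∣ (a : ℤ) ^ d - (b : ℤ) ^ d := by
    rw [← ratio_pow_eq_one_iff a b p d hpb, ← orderOf_dvd_iff_pow_eq_one, hord]; exact hed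
  have hp' := Nat.prime_iff_prime_int.1 hp.out
  have hpos : (a : ℤ) ^ d - (b : ℤ) ^ d ≠ 0 := by
    have : (b : ℤ) ^ d < (a : ℤ) ^ d := by
      have := Nat.pow_lt_pow_left hlt hd.ne'
      exact_mod_cast this
    omega
  have hdv := homEval_dvd2 a b d p hb hd hp.out.one_lt
  rw [pow_mul, pow_mul, ← geom_sum₂_mul ((a : ℤ) ^ d) ((b : ℤ) ^ d) p, mul_comm] at hdv
  have hdv2 := (mul_dvd_mul_iff_right hpos).1 hdv
  have hpa' : ¬ (p : ℤ) ∣ (a : ℤ) ^ d := fun h => hpa (by exact_mod_cast hp'.dvd_of_dvd_pow h)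
  have hpb' : ¬ (p : ℤ) ∣ (b : ℤ) ^ d := fun h => hpb (by exact_mod_cast hp'.dvd_of_dvd_pow h)
  intro hsq
  have hsq2 := hsq.trans hdv2
  rcases hp.out.eq_two_or_odd' with rfl | hodd
  · have he1 : e = 1 := by
      have := order_dvd_sub_one a b 2 hpa hpb
      rw [hord] at this
      simpa using this
    have hk0 : k ≠ 0 := by
      rintro rfl
      apply hne; rw [hd2, he1]; rfl
    obtain ⟨k, rfl⟩ := Nat.exists_eq_succ_of_ne_zero hk0
    have hd3 : d = 2 ^ k + 2 ^ k := by rw [hd2, he1, pow_succ]; ring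
    have hA : Odd (a : ℤ) := by
      rw [Int.odd_coe_nat, ← Nat.not_even_iff_odd, even_iff_two_dvd]; exact hpa
    have hB : Odd (b : ℤ) := by
      rw [Int.odd_coe_nat, ← Nat.not_even_iff_odd, even_iff_two_dvd]; exact hpb
    have hA2 : Odd ((a : ℤ) ^ 2 ^ k) := hA.pow
    have hB2 : Odd ((b : ℤ) ^ 2 ^ k) := hB.pow
    have hA4 := Int.sq_mod_four_eq_one_of_odd hA2
    have hB4 := Int.sq_mod_four_eq_one_of_odd hB2
    simp only [Finset.sum_range_succ, Finset.range_one, Finset.sum_singleton, pow_zero, one_mul,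
      pow_one, Nat.sub_self, mul_one, hd3, pow_add, ← sq] at hsq2
    norm_num at hsq2
    omega
  · have h1 := emultiplicity_geom_sum₂_eq_one hp' hodd hpd hpa'
    have h2 := le_emultiplicity_of_pow_dvd hsq2
    rw [h1] at h2
    norm_num at h2

lemma pow_sub_gt (a b P : ℕ) (hb : 0 < b) (hlt : b < a) (hP : 4 ≤ P) :
    b ^ P + P * (a + b) < a ^ P := by
  induction P, hP using Nat.le_induction with
  | base =>
    obtain ⟨c, rfl⟩ := Nat.exists_eq_add_of_lt hlt
    obtain ⟨b, rfl⟩ := Nat.exists_eq_add_of_lt hb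
    ring_nf
    have : 13 + b * 12 + b ^ 2 * 6 + b ^ 3 * 4 + b ^ 4 + c * 4 <
        16 + b * 32 + b ^ 2 * 24 + b ^ 3 * 8 + b ^ 4 + c * 32 := by
      nlinarith [Nat.zero_le (b ^ 2), Nat.zero_le (b ^ 3)]
    have h0 := Nat.zero_le (b * c * 48 + b * c ^ 2 * 24 + b * c ^ 3 * 4 + b ^ 2 * c * 24 +
      b ^ 2 * c ^ 2 * 6 + b ^ 3 * c * 4 + c ^ 2 * 24 + c ^ 3 * 8 + c ^ 4)
    linarith
  | succ P hP ih =>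
    have h1 : b ^ (P + 1) + (P + 1) * (a + b) ≤ a * (b ^ P + P * (a + b)) := by
      have : a * (P * (a + b)) ≥ 2 * (P * (a + b)) := Nat.mul_le_mul_right _ (by omega)
      have h3 : b ^ (P + 1) ≤ a * b ^ P := by
        rw [pow_succ, mul_comm]; exact Nat.mul_le_mul_right _ hlt.le
      nlinarith
    calc _ ≤ _ := h1
      _ < a * a ^ P := Nat.mul_lt_mul_of_pos_left ih (by omega)
      _ = _ := by ring

lemma pow_sub_gt3 (a b : ℕ) (hb : 0 < b) (hlt : b < a) (h : 3 ≤ a) :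
    b ^ 3 + 3 * (a + b) < a ^ 3 := by
  obtain ⟨c, rfl⟩ := Nat.exists_eq_add_of_lt hlt
  nlinarith [Nat.zero_le c, Nat.zero_le b, mul_pos hb hb, Nat.zero_le (c * b),
    Nat.mul_le_mul_right (b + c + 1 + b) h, Nat.zero_le (c * (b+c+1)^2), Nat.zero_le (c*b^2),
    Nat.zero_le (c * b * (b+c+1))]

lemma pow_sub_gt' (a b P : ℕ) (hb : 0 < b) (hlt : b < a) (hP : 2 ≤ P) :
    b ^ P + P < a ^ P := by
  induction P, hP using Nat.le_induction with
  | base => nlinarith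
  | succ P hP ih =>
    have : a * (b ^ P + P) < a * a ^ P := Nat.mul_lt_mul_of_pos_left ih (by omega)
    have h3 : b ^ (P + 1) ≤ a * b ^ P := by
        rw [pow_succ, mul_comm]; exact Nat.mul_le_mul_right _ hlt.le
    have : a ^ (P + 1) = a * a ^ P := by ring
    nlinarith

lemma homEval_gt_one (a b d : ℕ) (hb : 0 < b) (hlt : b < a) (hd : 2 ≤ d) :
    1 < homEval a b (cyclotomic d ℤ) := by
  have hb' : (0 : ℝ) < b := by exact_mod_cast hb
  have hlt' : (b : ℝ) + 1 ≤ a := by exact_mod_cast hlt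
  have h := homEval_cast ℝ a b hb'.ne' (cyclotomic d ℤ)
  rw [map_cyclotomic, natDegree_cyclotomic] at h
  have h1 : 1 < (a : ℝ) / b := by rw [one_lt_div hb']; linarith
  have h2 := sub_one_pow_totient_lt_cyclotomic_eval hd h1
  have h3 : (b : ℝ) ^ d.totient * ((a : ℝ) / b - 1) ^ d.totient = (a - b : ℝ) ^ d.totient := by
    rw [← mul_pow]; congr 1; field_simp
  have h4 : (1 : ℝ) ≤ (a - b : ℝ) ^ d.totient := one_le_pow₀ (by linarith)
  have h5 := mul_lt_mul_of_pos_left h2 (pow_pos hb' d.totient)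
  have : (1 : ℝ) < homEval a b (cyclotomic d ℤ) := by rw [h]; linarith
  exact_mod_cast this

/-- Lower bound when `P ^ 2 ∣ d * P`. -/
lemma homEval_gt_sq (a b d P : ℕ) (hP : P.Prime) (hb : 0 < b) (hlt : b < a) (hd : 0 < d)
    (hdiv : P ∣ d) : (P : ℤ) < homEval a b (cyclotomic (d * P) ℤ) := by
  have hb' : (0 : ℝ) < b := by exact_mod_cast hb
  have hlt' : (b : ℝ) + 1 ≤ a := by exact_mod_cast hlt
  have h := homEval_cast ℝ a b hb'.ne' (cyclotomic (d * P) ℤ)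
  rw [map_cyclotomic, natDegree_cyclotomic, ← cyclotomic_expand_eq_cyclotomic hP hdiv ℝ, expand_eval,
    mul_comm d P, Nat.totient_mul_of_prime_of_dvd hP hdiv] at h
  have h1 : 1 < ((a : ℝ) / b) ^ P :=
    one_lt_pow₀ (by rw [one_lt_div hb']; linarith) hP.ne_zero
  have h2 := sub_one_pow_totient_le_cyclotomic_eval h1 d
  have h3 : (b : ℝ) ^ (P * d.totient) * (((a : ℝ) / b) ^ P - 1) ^ d.totient
      = (a ^ P - b ^ P : ℝ) ^ d.totient := by
    rw [pow_mul, ← mul_pow]; congr 1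
    simp [div_pow, mul_sub, mul_div_cancel₀ _ (pow_ne_zero P hb'.ne')]
  have h0 : (P : ℝ) < a ^ P - b ^ P := by
    have := pow_sub_gt' a b P hb hlt hP.two_le
    have : (b : ℝ) ^ P + P < a ^ P := by exact_mod_cast this
    linarith
  have hP1 : (1 : ℝ) ≤ P := by exact_mod_cast hP.one_lt.le
  have h4 : (a ^ P - b ^ P : ℝ) ≤ (a ^ P - b ^ P : ℝ) ^ d.totient :=
    le_self_pow₀ (by linarith) (Nat.totient_pos.2 hd).ne'
  have h5 := mul_le_mul_of_nonneg_left h2 (pow_pos hb' (P * d.totient)).le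
  have : (P : ℝ) < homEval a b (cyclotomic (d * P) ℤ) := by rw [mul_comm d P, h]; linarith
  exact_mod_cast this

lemma homEval_gt_of (a b d P : ℕ) (hP : P.Prime) (hb : 0 < b) (hlt : b < a) (hd : 0 < d)
    (hdiv : ¬ P ∣ d) (hlow : b ^ P + P * (a + b) < a ^ P) :
    (P : ℤ) < homEval a b (cyclotomic (d * P) ℤ) := by
  have hb' : (0 : ℝ) < b := by exact_mod_cast hb
  have hlt' : (b : ℝ) + 1 ≤ a := by exact_mod_cast hlt
  have h := homEval_cast ℝ a b hb'.ne' (cyclotomic (d * P) ℤ)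
  have hexp := congrArg (eval ((a : ℝ) / b)) (cyclotomic_expand_eq_cyclotomic_mul hP hdiv ℝ)
  rw [expand_eval, eval_mul] at hexp
  rw [map_cyclotomic, natDegree_cyclotomic, 
    Nat.totient_mul ((Nat.coprime_comm.1 ((Nat.Prime.coprime_iff_not_dvd hP).2 hdiv))),
    Nat.totient_prime hP] at h
  have hu : 1 < (a : ℝ) / b := by rw [one_lt_div hb']; linarith
  have h1 : 1 < ((a : ℝ) / b) ^ P := one_lt_pow₀ hu hP.ne_zero
  have h2 := sub_one_pow_totient_le_cyclotomic_eval h1 d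
  have h2' := cyclotomic_eval_le_add_one_pow_totient hu d
  set t := d.totient with ht
  have ht0 : t ≠ 0 := (Nat.totient_pos.2 hd).ne'
  set F : ℝ := ((homEval a b (cyclotomic (d * P) ℤ) : ℤ) : ℝ) with hF
  set E := eval ((a : ℝ) / b) (cyclotomic d ℝ)
  set E2 := eval ((a : ℝ) / b) (cyclotomic (d * P) ℝ)
  have h3 : (b : ℝ) ^ (P * t) * (((a : ℝ) / b) ^ P - 1) ^ t
      = (a ^ P - b ^ P : ℝ) ^ t := by
    rw [pow_mul, ← mul_pow]; congr 1
    simp [div_pow, mul_sub, mul_div_cancel₀ _ (pow_ne_zero P hb'.ne')]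
  have h3' : (b : ℝ) ^ t * ((a : ℝ) / b + 1) ^ t = (a + b : ℝ) ^ t := by
    rw [← mul_pow]; congr 1; field_simp
  have h5 := mul_le_mul_of_nonneg_left h2 (pow_pos hb' (P * t)).le
  have h5' := mul_le_mul_of_nonneg_left h2' (pow_pos hb' t).le
  rw [h3] at h5
  rw [h3', ] at h5'
  have hsplit : P * t = t * (P - 1) + t := by
    obtain ⟨k, rfl⟩ := Nat.exists_eq_succ_of_ne_zero hP.ne_zero
    simp; ring
  have hkey : (a ^ P - b ^ P : ℝ) ^ t ≤ F * (b ^ t * E) := by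
    refine h5.trans (le_of_eq ?_)
    rw [hexp, hsplit, pow_add, h]; ring
  have hFpos : 0 < F := by
    have := homEval_gt_one a b (d * P) hb hlt (by nlinarith [hP.two_le])
    have : (1 : ℝ) < F := by rw [hF]; exact_mod_cast this
    linarith
  have hkey2 : (a ^ P - b ^ P : ℝ) ^ t ≤ F * (a + b) ^ t :=
    hkey.trans (mul_le_mul_of_nonneg_left h5' hFpos.le)
  have h0 : (P : ℝ) * (a + b) < a ^ P - b ^ P := by
    have : (b : ℝ) ^ P + P * (a + b) < a ^ P := by exact_mod_cast hlow
    linarith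
  have hP1 : (1 : ℝ) ≤ P := by exact_mod_cast hP.one_lt.le
  have hab0 : (0 : ℝ) < a + b := by linarith
  have h6 : ((P : ℝ) * (a + b)) ^ t < (a ^ P - b ^ P : ℝ) ^ t :=
    pow_lt_pow_left₀ h0 (by positivity) ht0
  rw [mul_pow] at h6
  have h7 : (P : ℝ) ≤ (P : ℝ) ^ t := le_self_pow₀ hP1 ht0
  have h8 : (P : ℝ) * (a + b) ^ t < F * (a + b) ^ t :=
    lt_of_le_of_lt (mul_le_mul_of_nonneg_right h7 (by positivity)) (h6.trans_le hkey2)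
  have : (P : ℝ) < F := lt_of_mul_lt_mul_right h8 (by positivity)
  rw [hF] at this
  exact_mod_cast this

lemma homEval_three (a b : ℕ) (hb : 0 < b) :
    homEval a b (cyclotomic 3 ℤ) = a ^ 2 + a * b + b ^ 2 := by
  have hb' : (b : ℚ) ≠ 0 := by positivity
  have h := homEval_cast ℚ a b hb' (cyclotomic 3 ℤ)
  rw [map_cyclotomic, natDegree_cyclotomic, cyclotomic_three ℚ,
    Nat.totient_prime Nat.prime_three] at h
  simp only [eval_add, eval_pow, eval_X, eval_one] at h
  have h' : ((homEval a b (cyclotomic 3 ℤ) : ℤ) : ℚ) = (a : ℚ) ^ 2 + a * b + b ^ 2 := by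
    rw [h]; field_simp
  exact_mod_cast h'

theorem zsigmondy (a b d : ℕ) (hb : 0 < b) (hlt : b < a) (hab : a.Coprime b) (hd : 2 < d)
    (hex : ¬ (d = 6 ∧ a = 2)) :
    ∃ p : ℕ, p.Prime ∧ d ∣ p - 1 ∧ ∀ j, (p : ℤ) ∣ (a : ℤ) ^ j - (b : ℤ) ^ j ↔ d ∣ j := by
  by_contra hcon
  have hall : ∀ p : ℕ, p.Prime → (p : ℤ) ∣ homEval a b (cyclotomic d ℤ) → p ∣ d := by
    intro p hp hdv
    by_contra hpd
    apply hcon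
    have := Fact.mk hp
    obtain ⟨h1, h2, h3⟩ := order_of_dvd a b p 0 d hb hab hpd (by simpa using hdv)
    refine ⟨p, hp, h3 ▸ order_dvd_sub_one a b p h1 h2, fun j => ?_⟩
    rw [← ratio_pow_eq_one_iff a b p j h2, ← orderOf_dvd_iff_pow_eq_one, h3]
  have h1 := homEval_gt_one a b d hb hlt hd.le
  obtain ⟨F, hF⟩ := Int.eq_ofNat_of_zero_le (by linarith : 0 ≤ homEval a b (cyclotomic d ℤ))
  have hF1 : 1 < F := by rw [hF] at h1; exact_mod_cast h1
  have horder : ∀ p : ℕ, p.Prime → p ∣ F → ∃ k e, d = p ^ (k + 1) * e ∧ ¬ p ∣ e ∧ e ∣ p - 1 := by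
    intro p hp hpF
    have := Fact.mk hp
    have hpF' : (p : ℤ) ∣ homEval a b (cyclotomic d ℤ) := by rw [hF]; exact_mod_cast hpF
    have hpd := hall p hp hpF'
    obtain ⟨k, e, hpe, hke⟩ := Nat.exists_eq_pow_mul_and_not_dvd (by omega : d ≠ 0) p hp.ne_one
    have hk : k ≠ 0 := by
      rintro rfl
      apply hpe
      rw [pow_zero, one_mul] at hke
      exact hke ▸ hpd
    obtain ⟨k, rfl⟩ := Nat.exists_eq_succ_of_ne_zero hk
    obtain ⟨h1, h2, h3⟩ := order_of_dvd a b p (k + 1) e hb hab hpe (by rw [← hke]; exact hpF')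
    exact ⟨k, e, hke, hpe, h3 ▸ order_dvd_sub_one a b p h1 h2⟩
  have hle : ∀ p q : ℕ, p.Prime → p ∣ F → q.Prime → q ∣ F → q ≤ p := by
    intro p q hp hpF hq hqF
    obtain ⟨k, e, hke, hpe, hep⟩ := horder p hp hpF
    have hqd := hall q hq (by rw [hF]; exact_mod_cast hqF)
    rw [hke] at hqd
    rcases (Nat.Prime.dvd_mul hq).1 hqd with h | h
    · exact Nat.le_of_dvd hp.pos (hq.dvd_of_dvd_pow h)
    · have := Nat.le_of_dvd (by have := hp.two_le; omega) (h.trans hep)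
      omega
  obtain ⟨p, hp, hpF⟩ := Nat.exists_prime_and_dvd hF1.ne'
  have := Fact.mk hp
  obtain ⟨k, e, hke, hpe, hep⟩ := horder p hp hpF
  have he0 : 0 < e := Nat.pos_of_ne_zero (by rintro rfl; simp at hpe)
  set d' := p ^ k * e with hd'
  have hdd : d = d' * p := by rw [hke, hd', pow_succ]; ring
  have hd'0 : 0 < d' := Nat.mul_pos (pow_pos hp.pos _) he0
  have hsq : ¬ p ^ 2 ∣ F := by
    intro h
    apply sq_not_dvd a b p d' hb hlt hab hd'0 (by omega)
    · rw [← hdd, hF]; exact_mod_cast hpF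
    · rw [← hdd, hF]; exact_mod_cast h
  have hFp : F = p := by
    obtain ⟨c, hc⟩ := hpF
    have hc1 : c = 1 := by
      by_contra hne
      obtain ⟨q, hq, hqc⟩ := Nat.exists_prime_and_dvd hne
      have hqF : q ∣ F := hc ▸ hqc.mul_left p
      have hqp : q = p := le_antisymm (hle p q hp (hc ▸ dvd_mul_right _ _) hq hqF)
        (hle q p hq hqF hp (hc ▸ dvd_mul_right _ _))
      apply hsq
      rw [hc, sq]
      exact mul_dvd_mul_left _ (hqp ▸ hqc)
    rw [hc, hc1, mul_one]
  have hnot : ¬ (p : ℤ) < homEval a b (cyclotomic (d' * p) ℤ) := by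
    rw [← hdd, hF, hFp]; simp
  apply hnot
  by_cases hpd' : p ∣ d'
  · exact homEval_gt_sq a b d' p hp hb hlt hd'0 hpd'
  · have hk0 : k = 0 := by
      by_contra hk
      exact hpd' ((dvd_pow_self p hk).mul_right e)
    have hd'e : d' = e := by rw [hd', hk0]; simp
    rcases lt_or_ge p 4 with h4 | h4
    · have hp2 := hp.two_le
      interval_cases p
      · have : e = 1 := by simpa using hep
        omega
      · have he2 : e = 1 ∨ e = 2 := by
          exact (Nat.dvd_prime Nat.prime_two).1 (by simpa using hep)
        rcases he2 with he | he
        · rw [hd'e, he, one_mul, homEval_three a b hb]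
          have : (1 : ℤ) ≤ b := by exact_mod_cast hb
          have : (b : ℤ) + 1 ≤ a := by exact_mod_cast hlt
          push_cast
          nlinarith
        · apply homEval_gt_of a b d' 3 hp hb hlt hd'0 hpd'
          apply pow_sub_gt3 a b hb hlt
          by_contra hlt3
          exact hex ⟨by omega, by omega⟩
    · exact homEval_gt_of a b d' p hp hb hlt hd'0 hpd' (pow_sub_gt a b p hb hlt h4)

/-- `(a ^ n - b ^ n) / (a - b)`. -/
def geomQ (a b n : ℕ) : ℕ := ∑ i ∈ Finset.range n, a ^ i * b ^ (n - 1 - i)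

lemma geomQ_mul (a b n : ℕ) (h : b ≤ a) : geomQ a b n * (a - b) = a ^ n - b ^ n :=
  geom_sum₂_mul_of_ge h n

lemma geomQ_mul_int (a b n : ℕ) :
    (geomQ a b n : ℤ) * ((a : ℤ) - b) = (a : ℤ) ^ n - (b : ℤ) ^ n := by
  rw [← geom_sum₂_mul]; simp [geomQ]

lemma geomQ_pos (a b n : ℕ) (h : b < a) (hn : 0 < n) : 0 < geomQ a b n := by
  apply Nat.pos_of_ne_zero
  intro h0
  have h1 := geomQ_mul a b n h.le
  rw [h0, zero_mul] at h1
  have := Nat.pow_lt_pow_left h hn.ne'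
  omega

lemma geomQ_scale (g a b n : ℕ) : geomQ (g * a) (g * b) n = g ^ (n - 1) * geomQ a b n := by
  unfold geomQ
  rw [Finset.mul_sum]
  apply Finset.sum_congr rfl
  intro i hi
  rw [Finset.mem_range] at hi
  have : n - 1 = i + (n - 1 - i) := by omega
  rw [mul_pow, mul_pow]
  conv_rhs => rw [this, pow_add]
  rw [← this]
  ring

lemma half_divisors (m q : ℕ) (hq : q.Prime) (hqm : q ∣ m) (hm : 0 < m) :
    m.divisors.card ≤ 2 * (m.divisors.filter (fun d => q ∣ d)).card := by
  rw [← Finset.card_filter_add_card_filter_not (s := m.divisors) (fun d => q ∣ d), two_mul]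
  apply Nat.add_le_add_left
  apply Finset.card_le_card_of_injOn (fun d => q * d)
  · intro d hd
    simp only [Finset.coe_filter, Set.mem_ofPred_eq, Nat.mem_divisors] at hd ⊢
    refine ⟨⟨?_, hm.ne'⟩, dvd_mul_right _ _⟩
    exact ((Nat.Prime.coprime_iff_not_dvd hq).2 hd.2).mul_dvd_of_dvd_of_dvd hqm hd.1.1
  · intro d _ e _ h
    exact Nat.eq_of_mul_eq_mul_left hq.pos h

lemma pow_card_dvd_totient (q : ℕ) (T : Finset ℕ) (hT : ∀ p ∈ T, p.Prime ∧ q ∣ p - 1) :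
    q ^ T.card ∣ Nat.totient (∏ p ∈ T, p) := by
  induction T using Finset.induction_on with
  | empty => simp
  | insert p T hp ih =>
    rw [Finset.prod_insert hp, Finset.card_insert_of_notMem hp, Nat.totient_mul, pow_succ, mul_comm]
    · apply mul_dvd_mul
      · rw [Nat.totient_prime (hT p (by simp)).1]; exact (hT p (by simp)).2
      · exact ih fun r hr => hT r (by simp [hr])
    · apply Nat.Coprime.prod_right
      intro r hr
      apply (Nat.coprime_primes (hT p (by simp)).1 (hT r (by simp [hr])).1).2
      rintro rfl
      exact hp hr

lemma key_totient (a b m q A : ℕ) (hq : q.Prime) (hA : A ≠ 0) (hGA : geomQ a b m ∣ A)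
    (S : Finset ℕ) (hS : ∀ d ∈ S, d ∣ m ∧ q ∣ d)
    (hZ : ∀ d ∈ S, ∃ p : ℕ, p.Prime ∧ d ∣ p - 1 ∧
      ∀ j, (p : ℤ) ∣ (a : ℤ) ^ j - (b : ℤ) ^ j ↔ d ∣ j) :
    q ^ (A.factorization q - 1 + S.card) ∣ Nat.totient A := by
  choose! P hP using hZ
  have hinj : Set.InjOn P S := by
    intro d hd e he h
    have h1 := (hP d hd).2.2
    have h2 := (hP e he).2.2
    rw [h] at h1
    exact Nat.dvd_antisymm ((h1 e).1 ((h2 e).2 dvd_rfl)) ((h2 d).1 ((h1 d).2 dvd_rfl))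
  have hT : ∀ p ∈ S.image P, p.Prime ∧ q ∣ p - 1 := by
    intro p hp
    obtain ⟨d, hd, rfl⟩ := Finset.mem_image.1 hp
    exact ⟨(hP d hd).1, (hS d hd).2.trans (hP d hd).2.1⟩
  have hTA : ∀ p ∈ S.image P, p ∣ A := by
    intro p hp
    obtain ⟨d, hd, rfl⟩ := Finset.mem_image.1 hp
    obtain ⟨hp, -, hj⟩ := hP d hd
    refine dvd_trans ?_ hGA
    have h1 := (hj m).2 (hS d hd).1
    rw [← geomQ_mul_int] at h1
    rcases (Nat.prime_iff_prime_int.1 hp).dvd_or_dvd h1 with h | h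
    · exact_mod_cast h
    · have h2 := (hj 1).1 (by simpa using h)
      have := Nat.dvd_one.1 ((hS d hd).2.trans h2)
      exact absurd this hq.ne_one
  have hprod : ∏ p ∈ S.image P, p ∣ A :=
    Finset.prod_primes_dvd A (fun p hp => (hT p hp).1.prime) hTA
  have hcop : (q ^ A.factorization q).Coprime (∏ p ∈ S.image P, p) := by
    apply Nat.Coprime.pow_left
    apply Nat.Coprime.prod_right
    intro p hp
    rw [Nat.coprime_primes hq (hT p hp).1]
    rintro rfl
    have h2 := (hT q hp).2
    have := Nat.le_of_dvd (by have := hq.two_le; omega) h2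
    have := hq.two_le
    omega
  have hdv : q ^ A.factorization q * ∏ p ∈ S.image P, p ∣ A :=
    hcop.mul_dvd_of_dvd_of_dvd (Nat.ordProj_dvd A q) hprod
  refine dvd_trans ?_ (Nat.totient_dvd_of_dvd hdv)
  rw [Nat.totient_mul hcop, pow_add]
  apply mul_dvd_mul
  · rcases Nat.eq_zero_or_pos (A.factorization q) with h | h
    · simp [h]
    · rw [Nat.totient_prime_pow hq h]; exact dvd_mul_right _ _
  · have := pow_card_dvd_totient q (S.image P) hT
    rwa [Finset.card_image_of_injOn hinj] at this

lemma dvd_transfer (a b n q k w : ℕ) (hq : q.Prime) (hab : a.Coprime b) (hlt : b < a)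
    (hn : 0 < n) (hqn : ¬ q ∣ n) (h : q ^ k ∣ w * geomQ a b n) :
    q ^ k ∣ w * geomQ a b (q - 1) := by
  have hq' := Nat.prime_iff_prime_int.1 hq
  by_cases hG : q ∣ geomQ a b n
  · have h1 : (q : ℤ) ∣ (a : ℤ) ^ n - (b : ℤ) ^ n := by
      rw [← geomQ_mul_int]; exact Dvd.dvd.mul_right (by exact_mod_cast hG) _
    obtain ⟨hqa, hqb⟩ := not_dvd_of_dvd_sub a b q n hq hab hn h1
    have : Fact q.Prime := ⟨hq⟩
    have h2 : (q : ℤ) ∣ ((a ^ (q - 1) : ℕ) : ℤ) - ((b ^ (q - 1) : ℕ) : ℤ) := by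
      push_cast
      rw [← ratio_pow_eq_one_iff a b q _ hqb, ← orderOf_dvd_iff_pow_eq_one]
      exact order_dvd_sub_one a b q hqa hqb
    have h3 : ¬ (q : ℤ) ∣ ((a ^ (q - 1) : ℕ) : ℤ) := by
      intro h; exact hqa (hq.dvd_of_dvd_pow (by exact_mod_cast h))
    have h4 := not_dvd_geom_sum₂ (n := n) hq' h2 h3 (by exact_mod_cast hqn)
    have h5 : ¬ q ∣ geomQ (a ^ (q - 1)) (b ^ (q - 1)) n := by
      intro h; apply h4
      have : (q : ℤ) ∣ (geomQ (a ^ (q - 1)) (b ^ (q - 1)) n : ℤ) := by exact_mod_cast h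
      simpa [geomQ] using this
    have h6 : geomQ a b n ∣ geomQ a b (q - 1) * geomQ (a ^ (q - 1)) (b ^ (q - 1)) n := by
      have hpos : 0 < a - b := by omega
      apply Nat.dvd_of_mul_dvd_mul_right hpos
      have e1 : geomQ a b (q - 1) * geomQ (a ^ (q - 1)) (b ^ (q - 1)) n * (a - b)
          = geomQ (a ^ n) (b ^ n) (q - 1) * (geomQ a b n * (a - b)) := by
        rw [mul_right_comm, geomQ_mul a b _ hlt.le, mul_comm,
          geomQ_mul _ _ _ (Nat.pow_le_pow_left hlt.le _),
          geomQ_mul a b _ hlt.le, geomQ_mul _ _ _ (Nat.pow_le_pow_left hlt.le _),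
          ← pow_mul, ← pow_mul, ← pow_mul, ← pow_mul, mul_comm n]
      rw [e1]; exact dvd_mul_left _ _
    have h7 : q ^ k ∣ (w * geomQ a b (q - 1)) * geomQ (a ^ (q - 1)) (b ^ (q - 1)) n := by
      rw [mul_assoc]; exact h.trans (mul_dvd_mul_left _ h6)
    exact (Nat.Coprime.pow_left k ((Nat.Prime.coprime_iff_not_dvd hq).2 h5)).dvd_of_dvd_mul_right h7
  · exact ((Nat.Coprime.pow_left k
      ((Nat.Prime.coprime_iff_not_dvd hq).2 hG)).dvd_of_dvd_mul_right h).mul_right _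

lemma pow_compare_aux (x k : ℕ) (h : k ≤ x) : (x + 1) ^ k ≤ (k + 1) * x ^ k := by
  induction k with
  | zero => simp
  | succ k ih =>
    have h1 := ih (by omega)
    calc (x + 1) ^ (k + 1) = (x + 1) ^ k * (x + 1) := pow_succ _ _
      _ ≤ (k + 1) * x ^ k * (x + 1) := Nat.mul_le_mul_right _ h1
      _ = (k + 1) * x ^ (k + 1) + (k + 1) * x ^ k := by ring
      _ ≤ (k + 1) * x ^ (k + 1) + x * x ^ k := by gcongr
      _ = _ := by ring

lemma pow_compare (q x : ℕ) (hq : 1 ≤ q) (h : q ≤ x) : x ^ (q - 1) ≤ q ^ x := by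
  induction x, h using Nat.le_induction with
  | base => exact Nat.pow_le_pow_right hq (by omega)
  | succ x hx ih =>
    have := pow_compare_aux x (q - 1) (by omega)
    rw [Nat.sub_add_cancel hq] at this
    calc _ ≤ _ := this
      _ ≤ q * q ^ x := Nat.mul_le_mul_left _ ih
      _ = _ := by ring

lemma two_one_order (j : ℕ) : ((3 : ℕ) : ℤ) ∣ ((2 : ℕ) : ℤ) ^ j - ((1 : ℕ) : ℤ) ^ j ↔ 2 ∣ j := by
  have h4 : ∀ k : ℕ, ∃ c : ℤ, (4 : ℤ) ^ k = 3 * c + 1 := by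
    intro k
    induction k with
    | zero => exact ⟨0, by simp⟩
    | succ k ih =>
      obtain ⟨c, hc⟩ := ih
      exact ⟨4 * c + 1, by rw [pow_succ, hc]; ring⟩
  obtain ⟨k, hk⟩ := Nat.even_or_odd' j
  obtain ⟨c, hc⟩ := h4 k
  push_cast
  rw [one_pow]
  rcases hk with rfl | rfl
  · rw [pow_mul]; norm_num [hc]
  · rw [pow_succ, pow_mul]; norm_num [hc]; omega

lemma two_pow_omega_le (m : ℕ) (hm : 0 < m) : 2 ^ m.primeFactors.card ≤ m.divisors.card := by
  rw [Nat.card_divisors hm.ne', ← Finset.prod_const]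
  apply Finset.prod_le_prod'
  intro p hp
  have := (Nat.prime_of_mem_primeFactors hp).factorization_pos_of_dvd hm.ne'
    (Nat.dvd_of_mem_primeFactors hp)
  omega

lemma core (g a b z m n q : ℕ) (hg : 0 < g) (hb : 0 < b) (hlt : b < a) (hab : a.Coprime b)
    (hz : 0 < z) (hn : 0 < n) (hmn : n < m) (hgcd : Nat.gcd m n = 1) (hq : q.Prime) (hqm : q ∣ m)
    (heq : Nat.totient (z * (g ^ (m - 1) * geomQ a b m)) = z * (g ^ (n - 1) * geomQ a b n))
    (S : Finset ℕ) (hS : ∀ d ∈ S, d ∣ m ∧ q ∣ d)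
    (hZ : ∀ d ∈ S, ∃ p : ℕ, p.Prime ∧ d ∣ p - 1 ∧
      ∀ j, (p : ℤ) ∣ (a : ℤ) ^ j - (b : ℤ) ^ j ↔ d ∣ j) :
    q ^ S.card ∣ z * geomQ a b (q - 1) ∧ (q = 2 → S.card ≤ 1) := by
  have hGm := geomQ_pos a b m hlt (by omega)
  have hGq := geomQ_pos a b (q - 1) hlt (by have := hq.two_le; omega)
  have hqn : ¬ q ∣ n := fun h => hq.ne_one (Nat.dvd_one.1 (hgcd ▸ Nat.dvd_gcd hqm h))
  have h1 := key_totient a b m q (z * (g ^ (m - 1) * geomQ a b m)) hq (by positivity)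
    (Dvd.intro_left (z * g ^ (m - 1)) (by ring)) S hS hZ
  rw [heq, ← mul_assoc z (g ^ (n - 1))] at h1
  have h2 := dvd_transfer a b n q _ _ hq hab hlt hn hqn h1
  rw [hq.pow_dvd_iff_le_factorization (by positivity)] at h2
  rw [Nat.factorization_mul (by positivity) (by positivity),
    Nat.factorization_mul (by positivity) (by positivity),
    Nat.factorization_mul (by positivity) (by positivity),
    Nat.factorization_mul (by positivity) (by positivity),
    Nat.factorization_pow, Nat.factorization_pow] at h2
  simp only [Finsupp.add_apply, Finsupp.smul_apply, smul_eq_mul] at h2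
  have hmul : (m - 1) * g.factorization q = (m - n) * g.factorization q + (n - 1) * g.factorization q := by
    rw [← add_mul]; congr 1; omega
  have hge : g.factorization q ≤ (m - n) * g.factorization q :=
    Nat.le_mul_of_pos_left _ (by omega)
  constructor
  · rw [hq.pow_dvd_iff_le_factorization (by positivity),
      Nat.factorization_mul (by positivity) (by positivity)]
    simp only [Finsupp.add_apply]
    rcases Nat.eq_zero_or_pos (g.factorization q) with h0 | h0
    · rw [h0] at h2; simp only [mul_zero] at h2; omega
    · omega
  · rintro rfl
    have : geomQ a b (2 - 1) = 1 := by simp [geomQ]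
    rw [this] at h2
    simp at h2
    omega

end

theorem divisor_bounds (x y z m n : ℕ) (hx : 0 < x) (hy : 0 < y) (hz : 0 < z)
    (hm : 0 < m) (hn : 0 < n) (hxy : y < x) (hzxy : z ≤ x - y)
    (hgcd : Nat.gcd m n = 1) (hmn : n < m)
    (heq : Nat.totient (z * ((x ^ m - y ^ m) / (x - y))) =
      z * ((x ^ n - y ^ n) / (x - y))) :
    m.divisors.card < 2 * max m.minFac x ∧
    (m.primeFactors.card : ℝ) <
      Real.log (2 * (max m.minFac x : ℕ)) / Real.log 2 := by
  have hmain : m.divisors.card < 2 * max m.minFac x := by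
    have hxy0 : 0 < x - y := by omega
    rw [← geomQ_mul x y m hxy.le, ← geomQ_mul x y n hxy.le, Nat.mul_div_cancel _ hxy0,
      Nat.mul_div_cancel _ hxy0] at heq
    obtain ⟨g, a, b, hg, hab, rfl, rfl⟩ : ∃ g a b : ℕ, 0 < g ∧ a.Coprime b ∧ x = g * a ∧ y = g * b := by
      obtain ⟨g, a, b, h1, h2, h3, h4⟩ := Nat.exists_coprime' (m := x) (n := y)
        (Nat.gcd_pos_of_pos_left _ hx)
      exact ⟨g, a, b, h1, h2, by rw [h3, mul_comm], by rw [h4, mul_comm]⟩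
    have hb : 0 < b := Nat.pos_of_mul_pos_left hy
    have hlt : b < a := Nat.lt_of_mul_lt_mul_left hxy
    rw [geomQ_scale, geomQ_scale] at heq
    have hq : m.minFac.Prime := Nat.minFac_prime (by omega)
    have hqm := Nat.minFac_dvd m
    have hhalf := half_divisors m _ hq hqm hm
    rcases hq.eq_two_or_odd' with h2 | hodd
    · rw [h2] at hhalf hqm ⊢
      set D := m.divisors.filter (fun d => 2 ∣ d) with hD
      set e := if a = 2 then 6 else 2 with he
      have hcard : D.card ≤ (D.erase e).card + 1 := by
        have := Finset.pred_card_le_card_erase (s := D) (a := e)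
        omega
      have hmem : ∀ d ∈ D.erase e, d ≠ e ∧ d ∣ m ∧ 2 ∣ d := by
        intro d hd
        simp only [hD, Finset.mem_erase, Finset.mem_filter, Nat.mem_divisors] at hd
        exact ⟨hd.1, hd.2.1.1, hd.2.2⟩
      obtain ⟨h3, h4⟩ := core g a b z m n 2 hg hb hlt hab hz hn hmn hgcd Nat.prime_two hqm heq
        (D.erase e) (fun d hd => (hmem d hd).2) (by
          intro d hd
          obtain ⟨hde, hdm, h2d⟩ := hmem d hd
          have hd0 : 0 < d := Nat.pos_of_dvd_of_pos hdm hm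
          by_cases hd2 : d = 2
          · have ha : a = 2 := by
              by_contra ha
              rw [he, if_neg ha] at hde
              exact hde hd2
            have hb1 : b = 1 := by omega
            subst ha hb1 hd2
            exact ⟨3, Nat.prime_three, by norm_num, two_one_order⟩
          · apply zsigmondy a b d hb hlt hab (by omega)
            rintro ⟨h6, ha⟩
            rw [he, if_pos ha] at hde
            exact hde h6)
      have h4 := h4 rfl
      have hga : a ≤ g * a := Nat.le_mul_of_pos_left _ hg
      have hmax : g * a ≤ max 2 (g * a) := le_max_right _ _
      rcases Nat.lt_or_ge 2 (g * a) with h5 | h5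
      · omega
      · have hz1 : z = 1 := by
          have : 0 < g * b := hy
          omega
        have hG1 : geomQ a b (2 - 1) = 1 := by simp [geomQ]
        rw [hz1, hG1] at h3
        have h6 := Nat.dvd_one.1 h3
        have h7 : (D.erase e).card = 0 := by
          by_contra hne
          have := Nat.one_lt_pow hne (by norm_num : 1 < 2)
          omega
        omega
    · set q := m.minFac with hqdef
      set D := m.divisors.filter (fun d => q ∣ d) with hD
      have hmem : ∀ d ∈ D, d ∣ m ∧ q ∣ d := by
        intro d hd
        simp only [hD, Finset.mem_filter, Nat.mem_divisors] at hd
        exact ⟨hd.1.1, hd.2⟩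
      have hm2 : ¬ 2 ∣ m := by
        intro h
        have h1 := Nat.minFac_le_of_dvd le_rfl h
        have := hq.two_le
        have h3 : q = 2 := by omega
        rw [h3] at hodd
        exact absurd hodd (by decide)
      obtain ⟨h3, -⟩ := core g a b z m n q hg hb hlt hab hz hn hmn hgcd hq hqm heq
        D hmem (by
          intro d hd
          obtain ⟨hdm, h2d⟩ := hmem d hd
          have hd0 : 0 < d := Nat.pos_of_dvd_of_pos hdm hm
          have hqd := Nat.le_of_dvd hd0 h2d
          have := hq.two_le
          have hd2 : ¬ 2 ∣ d := fun h => hm2 (h.trans hdm)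
          apply zsigmondy a b d hb hlt hab (by omega)
          rintro ⟨h6, ha⟩
          omega)
      have hq2 := hq.two_le
      have hGq := geomQ_pos a b (q - 1) hlt (by omega)
      have h4 := Nat.le_of_dvd (by positivity) h3
      have h5 : z * geomQ a b (q - 1) < (g * a) ^ (q - 1) := by
        calc z * geomQ a b (q - 1) ≤ (g * a - g * b) * geomQ a b (q - 1) :=
              Nat.mul_le_mul_right _ hzxy
          _ = g * (a ^ (q - 1) - b ^ (q - 1)) := by
              rw [← Nat.mul_sub, ← geomQ_mul a b _ hlt.le]; ring
          _ < g * a ^ (q - 1) := by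
              apply Nat.mul_lt_mul_of_pos_left _ hg
              have h1 : 0 < b ^ (q - 1) := by positivity
              have h2 : 0 < a ^ (q - 1) := pow_pos (by omega) _
              omega
          _ ≤ g ^ (q - 1) * a ^ (q - 1) :=
              Nat.mul_le_mul_right _ (Nat.le_self_pow (by omega) g)
          _ = _ := (mul_pow _ _ _).symm
      have h6 : q ^ D.card < (g * a) ^ (q - 1) := lt_of_le_of_lt h4 h5
      by_contra hcon
      have hD1 : max q (g * a) ≤ D.card := by omega
      rcases le_total (g * a) q with hle | hle
      · have h7 : (g * a) ^ (q - 1) ≤ q ^ (q - 1) := Nat.pow_le_pow_left hle _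
        have h8 : q ^ (q - 1) ≤ q ^ D.card :=
          Nat.pow_le_pow_right (by omega) (by have := le_max_left q (g * a); omega)
        omega
      · have h7 := pow_compare q (g * a) (by omega) hle
        have h8 : q ^ (g * a) ≤ q ^ D.card :=
          Nat.pow_le_pow_right (by omega) ((le_max_right _ _).trans hD1)
        omega
  refine ⟨hmain, ?_⟩
  have hl2 : 0 < Real.log 2 := Real.log_pos (by norm_num)
  rw [lt_div_iff₀ hl2, ← Real.log_pow]
  apply Real.log_lt_log (by positivity)
  have := lt_of_le_of_lt (two_pow_omega_le m hm) hmain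
  exact_mod_cast this
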